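/- arXiv:1911.04587 — 6 statements merged into one kernel-verified Lean document; each statement's English description precedes it below -/
import Mathlib

section
/- Let σ > 0 and a, b ∈ ℝ, and for c ∈ ℝ let Lap_σ(c) denote the measure on ℝ with density x ↦ (1/(2σ))·exp(−|x−c|/σ) with respect to Lebesgue measure. Then for every measurable set Z ⊆ ℝ, Lap_σ(a)(Z) ≤ exp(|a−b|/σ) · Lap_σ(b)(Z). -/
open MeasureTheory

/-- The Laplace measure on ℝ with scale `σ` centered at `c`: the measure with
density `x ↦ (1/(2σ))·exp(−|x−c|/σ)` with respect to Lebesgue measure. -/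
noncomputable def lapMeasure (σ c : ℝ) : Measure ℝ :=
  volume.withDensity fun x => ENNReal.ofReal ((1 / (2 * σ)) * Real.exp (-|x - c| / σ))

/-- The Laplace density centered at `a` is at most `exp (|a - b| / σ)` times the one centered
at `b`. -/
theorem laplace_density_le (σ : ℝ) (hσ : 0 < σ) (a b x : ℝ) :
    (1 / (2 * σ)) * Real.exp (-|x - a| / σ) ≤
      Real.exp (|a - b| / σ) * ((1 / (2 * σ)) * Real.exp (-|x - b| / σ)) := by
  rw [mul_left_comm, ← Real.exp_add, ← add_div]
  gcongr
  linarith [abs_sub_le x a b]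

/-- One-dimensional Laplace mechanism guarantee: for σ > 0 and a, b ∈ ℝ,
for every measurable set Z ⊆ ℝ, `Lap_σ(a)(Z) ≤ exp(|a−b|/σ) · Lap_σ(b)(Z)`. -/
theorem laplace_mechanism_one_dim (σ : ℝ) (hσ : 0 < σ) (a b : ℝ)
    (Z : Set ℝ) (hZ : MeasurableSet Z) :
    lapMeasure σ a Z ≤ ENNReal.ofReal (Real.exp (|a - b| / σ)) * lapMeasure σ b Z := by
  rw [lapMeasure, lapMeasure, withDensity_apply _ hZ, withDensity_apply _ hZ,
    ← lintegral_const_mul' _ _ ENNReal.ofReal_ne_top]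
  refine lintegral_mono fun x => ?_
  rw [← ENNReal.ofReal_mul (Real.exp_pos _).le]
  exact ENNReal.ofReal_le_ofReal (laplace_density_le σ hσ a b x)
end

section
/- Let d ∈ ℕ and let x, x' : Fin d → ℝ and y, y' ∈ ℝ satisfy |x_a| ≤ 1 and |x'_a| ≤ 1 for all a, and |y| ≤ 1, |y'| ≤ 1. Then |y² − y'²| + ∑_{a=1}^{d} |2·y·x_a − 2·y'·x'_a| + ∑_{a=1}^{d} ∑_{b=1}^{d} |x_a·x_b − x'_a·x'_b| ≤ 2·(1 + 2d + d²). -/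
/-- Two products of reals of absolute value at most `1` differ by at most `2`. -/
theorem abs_mul_sub_mul_le_two {a b c e : ℝ} (ha : |a| ≤ 1) (hb : |b| ≤ 1) (hc : |c| ≤ 1)
    (he : |e| ≤ 1) : |a * b - c * e| ≤ 2 := by
  have hab : |a * b| ≤ 1 := abs_mul a b ▸ mul_le_one₀ ha (abs_nonneg b) hb
  have hce : |c * e| ≤ 1 := abs_mul c e ▸ mul_le_one₀ hc (abs_nonneg e) he
  linarith [abs_sub (a * b) (c * e)]

/-- Global sensitivity `Δ_f = 2(1 + 2d + d²)` of the linear-regression objective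
used by the functional mechanism: the ℓ₁ change of the polynomial coefficient
vector (constant term `y²`, first-order `2·y·x_a`, second-order `x_a·x_b`)
when one record with features in [−1,1]^d and label in [−1,1] changes. -/
theorem linear_regression_global_sensitivity (d : ℕ) (x x' : Fin d → ℝ) (y y' : ℝ)
    (hx : ∀ a, |x a| ≤ 1) (hx' : ∀ a, |x' a| ≤ 1) (hy : |y| ≤ 1) (hy' : |y'| ≤ 1) :
    |y ^ 2 - y' ^ 2| + (∑ a, |2 * y * x a - 2 * y' * x' a|)
        + ∑ a, ∑ b, |x a * x b - x' a * x' b|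
      ≤ 2 * (1 + 2 * (d : ℝ) + (d : ℝ) ^ 2) := by
  have h₀ : |y ^ 2 - y' ^ 2| ≤ 2 := by
    simpa only [sq] using abs_mul_sub_mul_le_two hy hy hy' hy'
  have h₁ : ∑ a, |2 * y * x a - 2 * y' * x' a| ≤ d * 4 := by
    have h (a : Fin d) : |2 * y * x a - 2 * y' * x' a| ≤ 4 := by
      rw [mul_assoc, mul_assoc, ← mul_sub, abs_mul, abs_two]
      linarith [abs_mul_sub_mul_le_two hy (hx a) hy' (hx' a)]
    simpa using Finset.sum_le_sum fun a (_ : a ∈ Finset.univ) => h a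
  have h₂ : ∑ a, ∑ b, |x a * x b - x' a * x' b| ≤ d * (d * 2) := by
    simpa using Finset.sum_le_sum fun a (_ : a ∈ Finset.univ) =>
      Finset.sum_le_sum fun b (_ : b ∈ Finset.univ) =>
        abs_mul_sub_mul_le_two (hx a) (hx b) (hx' a) (hx' b)
  linarith
end

section
/- Let d ∈ ℕ and let x, x' : Fin d → ℝ and y, y' ∈ ℝ satisfy |x_a| ≤ 1 and |x'_a| ≤ 1 for all a, y ∈ {0,1}, and y' ∈ {0,1}. Then ∑_{a=1}^{d} |(1/2 − y)·x_a − (1/2 − y')·x'_a| + ∑_{a=1}^{d} ∑_{b=1}^{d} |(1/8)·x_a·x_b − (1/8)·x'_a·x'_b| ≤ d²/4 + d. -/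
/-- Two products whose factors are bounded by `c` and by `1` differ by at most `2 * c`. -/
theorem abs_mul_sub_mul_le_two_mul {c u u' v v' : ℝ} (hu : |u| ≤ c) (hu' : |u'| ≤ c)
    (hv : |v| ≤ 1) (hv' : |v'| ≤ 1) : |u * v - u' * v'| ≤ 2 * c := by
  have h : |u * v| ≤ c := by
    rw [abs_mul]
    exact (mul_le_of_le_one_right (abs_nonneg u) hv).trans hu
  have h' : |u' * v'| ≤ c := by
    rw [abs_mul]
    exact (mul_le_of_le_one_right (abs_nonneg u') hv').trans hu'
  linarith [abs_sub (u * v) (u' * v')]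

/-- Global sensitivity `Δ_f = d²/4 + d` of the order-2 Taylor-approximated
logistic-regression objective: the ℓ₁ change of the polynomial coefficient
vector (first-order `(1/2 − y)·x_a`, second-order `(1/8)·x_a·x_b`) when one
record with features in [−1,1]^d and label in {0,1} changes. -/
theorem logistic_regression_global_sensitivity (d : ℕ) (x x' : Fin d → ℝ) (y y' : ℝ)
    (hx : ∀ a, |x a| ≤ 1) (hx' : ∀ a, |x' a| ≤ 1)
    (hy : y = 0 ∨ y = 1) (hy' : y' = 0 ∨ y' = 1) :
    (∑ a, |(1 / 2 - y) * x a - (1 / 2 - y') * x' a|)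
        + ∑ a, ∑ b, |(1 / 8) * (x a * x b) - (1 / 8) * (x' a * x' b)|
      ≤ (d : ℝ) ^ 2 / 4 + (d : ℝ) := by
  have label_bound {z : ℝ} (hz : z = 0 ∨ z = 1) : |1 / 2 - z| ≤ 1 / 2 := by
    rcases hz with rfl | rfl <;> norm_num [abs_le]
  have prod_bound {z : Fin d → ℝ} (hz : ∀ a, |z a| ≤ 1) (a b : Fin d) : |z a * z b| ≤ 1 := by
    rw [abs_mul]
    exact mul_le_one₀ (hz a) (abs_nonneg _) (hz b)
  have first_order : ∑ a, |(1 / 2 - y) * x a - (1 / 2 - y') * x' a| ≤ ∑ _a : Fin d, (1 : ℝ) :=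
    Finset.sum_le_sum fun a _ =>
      (abs_mul_sub_mul_le_two_mul (label_bound hy) (label_bound hy') (hx a) (hx' a)).trans
        (by norm_num)
  have second_order : ∑ a, ∑ b, |(1 / 8) * (x a * x b) - (1 / 8) * (x' a * x' b)|
      ≤ ∑ _a : Fin d, ∑ _b : Fin d, (1 / 4 : ℝ) :=
    Finset.sum_le_sum fun a _ => Finset.sum_le_sum fun b _ =>
      (abs_mul_sub_mul_le_two_mul (c := 1 / 8) (by norm_num [abs_le]) (by norm_num [abs_le])
        (prod_bound hx a b) (prod_bound hx' a b)).trans (by norm_num)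
  simp only [Finset.sum_const, Finset.card_univ, Fintype.card_fin, nsmul_eq_mul]
    at first_order second_order
  linarith
end

section
/- Let d ∈ ℕ, let S₁ ⊆ Fin d with |S₁| = d¹, and let x, x' : Fin d → ℝ and y, y' ∈ ℝ satisfy |x_a| ≤ 1, |x'_a| ≤ 1 for all a, y ∈ {0,1}, and y' ∈ {0,1}. Then ∑_{a=1}^{d} |(1/2 − y)·x_a − (1/2 − y')·x'_a| + ∑_{(a,b) : a ∈ S₁ ∨ b ∈ S₁} |(1/8)·x_a·x_b − (1/8)·x'_a·x'_b| ≤ d + d¹·(2d − d¹)/4. -/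
/-- The number of ordered pairs with at least one component in `s`. -/
theorem card_filter_fst_mem_or_snd_mem {α : Type*} [Fintype α] [DecidableEq α] (s : Finset α) :
    ((Finset.univ.filter (fun p : α × α => p.1 ∈ s ∨ p.2 ∈ s)).card : ℝ)
      = s.card * (2 * Fintype.card α - s.card) := by
  have hcompl : Finset.univ.filter (fun p : α × α => p.1 ∈ s ∨ p.2 ∈ s) = (sᶜ ×ˢ sᶜ)ᶜ := by
    ext p
    simp only [Finset.mem_filter, Finset.mem_univ, true_and, Finset.mem_compl,
      Finset.mem_product]
    tauto
  have hprod := Finset.card_add_card_compl (sᶜ ×ˢ sᶜ)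
  have hs := Finset.card_add_card_compl s
  rw [Finset.card_product, Fintype.card_prod] at hprod
  rw [hcompl, ← hs]
  rw [← hs] at hprod
  have hprod' : (sᶜ.card * sᶜ.card + ((sᶜ ×ˢ sᶜ)ᶜ).card : ℝ)
      = (s.card + sᶜ.card) * (s.card + sᶜ.card) := mod_cast hprod
  push_cast
  linarith

/-- Two scaled points of `[-1, 1]` differ by at most the sum of the absolute scales. -/
theorem abs_mul_sub_mul_le_abs_add_abs {c c' u v : ℝ} (hu : |u| ≤ 1) (hv : |v| ≤ 1) :
    |c * u - c' * v| ≤ |c| + |c'| := by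
  refine (abs_sub _ _).trans (add_le_add ?_ ?_) <;> rw [abs_mul]
  · exact mul_le_of_le_one_right (abs_nonneg c) hu
  · exact mul_le_of_le_one_right (abs_nonneg c') hv

/-- Local sensitivity `Δ_f^1 = d + d¹(2d − d¹)/4` of the order-2
Taylor-approximated logistic-regression objective regarding the label-owning
party P₁: party P₁ owns the feature subset S₁ of size `d¹` and the label, so
the coefficients involving its data are all first-order coefficients
`(1/2 − y)·x_a` and the second-order coefficients `(1/8)·x_a·x_b` indexed by
ordered pairs `(a,b)` with `a ∈ S₁` or `b ∈ S₁`. -/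
theorem logistic_regression_local_sensitivity_party1 (d : ℕ) (S₁ : Finset (Fin d))
    (d1 : ℕ) (hcard : S₁.card = d1) (x x' : Fin d → ℝ) (y y' : ℝ)
    (hx : ∀ a, |x a| ≤ 1) (hx' : ∀ a, |x' a| ≤ 1)
    (hy : y = 0 ∨ y = 1) (hy' : y' = 0 ∨ y' = 1) :
    (∑ a, |(1 / 2 - y) * x a - (1 / 2 - y') * x' a|)
        + ∑ p ∈ Finset.univ.filter (fun p : Fin d × Fin d => p.1 ∈ S₁ ∨ p.2 ∈ S₁),
            |(1 / 8) * (x p.1 * x p.2) - (1 / 8) * (x' p.1 * x' p.2)|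
      ≤ (d : ℝ) + (d1 : ℝ) * (2 * (d : ℝ) - (d1 : ℝ)) / 4 := by
  have habs : ∀ z : ℝ, z = 0 ∨ z = 1 → |1 / 2 - z| = 1 / 2 := by
    rintro z (rfl | rfl) <;> norm_num [abs_of_pos, abs_of_neg]
  have hmul : ∀ z : Fin d → ℝ, (∀ a, |z a| ≤ 1) → ∀ a b, |z a * z b| ≤ 1 := by
    intro z hz a b
    rw [abs_mul]
    exact mul_le_one₀ (hz a) (abs_nonneg _) (hz b)
  have hfirst : ∑ a, |(1 / 2 - y) * x a - (1 / 2 - y') * x' a| ≤ (d : ℝ) := by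
    have h := Finset.sum_le_card_nsmul Finset.univ
      (fun a => |(1 / 2 - y) * x a - (1 / 2 - y') * x' a|) 1 fun a _ => by
        have := abs_mul_sub_mul_le_abs_add_abs (c := 1 / 2 - y) (c' := 1 / 2 - y') (hx a) (hx' a)
        rw [habs y hy, habs y' hy'] at this
        linarith
    simpa using h
  have hsecond := Finset.sum_le_card_nsmul
    (Finset.univ.filter (fun p : Fin d × Fin d => p.1 ∈ S₁ ∨ p.2 ∈ S₁))
    (fun p => |(1 / 8) * (x p.1 * x p.2) - (1 / 8) * (x' p.1 * x' p.2)|) (1 / 4) fun p _ => by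
      have := abs_mul_sub_mul_le_abs_add_abs (c := 1 / 8) (c' := 1 / 8)
        (hmul x hx p.1 p.2) (hmul x' hx' p.1 p.2)
      rw [abs_of_pos (by norm_num : (0 : ℝ) < 1 / 8)] at this
      linarith
  rw [nsmul_eq_mul, card_filter_fst_mem_or_snd_mem, Fintype.card_fin, hcard] at hsecond
  linarith
end

section
/- Let d ∈ ℕ, let S_k ⊆ Fin d with |S_k| = d^k, let y ∈ {0,1}, and let x, x' : Fin d → ℝ satisfy |x_a| ≤ 1 and |x'_a| ≤ 1 for all a. Then ∑_{a ∈ S_k} |(1/2 − y)·x_a − (1/2 − y)·x'_a| + ∑_{(a,b) : a ∈ S_k ∨ b ∈ S_k} |(1/8)·x_a·x_b − (1/8)·x'_a·x'_b| ≤ d^k + d^k·(2d − d^k)/4. -/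
/-- The number of ordered pairs with at least one coordinate in `s`. -/
theorem Finset.cast_card_filter_fst_mem_or_snd_mem {α : Type*} [Fintype α] [DecidableEq α]
    (s : Finset α) :
    ((Finset.univ.filter (fun p : α × α => p.1 ∈ s ∨ p.2 ∈ s)).card : ℝ)
      = s.card * (2 * (Fintype.card α : ℝ) - s.card) := by
  have hcompl : Finset.univ.filter (fun p : α × α => ¬(p.1 ∈ s ∨ p.2 ∈ s)) = sᶜ ×ˢ sᶜ := by
    ext p
    simp
  have hsplit := Finset.card_filter_add_card_filter_not (s := (Finset.univ : Finset (α × α)))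
    (fun p : α × α => p.1 ∈ s ∨ p.2 ∈ s)
  rw [hcompl, Finset.card_product, Finset.card_univ, Fintype.card_prod] at hsplit
  have hs : (s.card : ℝ) + (sᶜ.card : ℝ) = Fintype.card α := by
    exact_mod_cast s.card_add_card_compl
  have hsplit' : ((Finset.univ.filter (fun p : α × α => p.1 ∈ s ∨ p.2 ∈ s)).card : ℝ)
      + (sᶜ.card : ℝ) * sᶜ.card = (Fintype.card α : ℝ) * Fintype.card α := by
    exact_mod_cast hsplit
  rw [← hs] at hsplit' ⊢
  linear_combination hsplit'

/-- Scaling two numbers of absolute value at most one by `c` moves them at most `2 * |c|` apart. -/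
theorem abs_mul_sub_mul_le_two_mul_abs (c : ℝ) {u v : ℝ} (hu : |u| ≤ 1) (hv : |v| ≤ 1) :
    |c * u - c * v| ≤ 2 * |c| := by
  rw [← mul_sub, abs_mul, mul_comm]
  have huv : |u - v| ≤ 2 := (abs_sub u v).trans (by linarith)
  exact mul_le_mul_of_nonneg_right huv (abs_nonneg c)

/-- Local sensitivity `Δ_f^k = d^k + d^k(2d − d^k)/4` of the order-2
Taylor-approximated logistic-regression objective regarding a non-label-owning
party P_k: party P_k owns the feature subset S_k of size `d^k`; the coefficients
involving its data are the first-order coefficients `(1/2 − y)·x_a` with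
`a ∈ S_k` and the second-order coefficients `(1/8)·x_a·x_b` indexed by ordered
pairs `(a,b)` with `a ∈ S_k` or `b ∈ S_k`; the label `y` (owned by P₁) is
unchanged. -/
theorem logistic_regression_local_sensitivity_partyk (d : ℕ) (Sk : Finset (Fin d))
    (dk : ℕ) (hcard : Sk.card = dk) (y : ℝ) (hy : y = 0 ∨ y = 1)
    (x x' : Fin d → ℝ) (hx : ∀ a, |x a| ≤ 1) (hx' : ∀ a, |x' a| ≤ 1) :
    (∑ a ∈ Sk, |(1 / 2 - y) * x a - (1 / 2 - y) * x' a|)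
        + ∑ p ∈ Finset.univ.filter (fun p : Fin d × Fin d => p.1 ∈ Sk ∨ p.2 ∈ Sk),
            |(1 / 8) * (x p.1 * x p.2) - (1 / 8) * (x' p.1 * x' p.2)|
      ≤ (dk : ℝ) + (dk : ℝ) * (2 * (d : ℝ) - (dk : ℝ)) / 4 := by
  have hy' : |1 / 2 - y| = 1 / 2 := by
    rcases hy with rfl | rfl <;> norm_num [abs_of_neg]
  have hfirst : ∑ a ∈ Sk, |(1 / 2 - y) * x a - (1 / 2 - y) * x' a| ≤ dk := by
    refine (Finset.sum_le_card_nsmul Sk _ 1 fun a _ => ?_).trans (by simp [hcard])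
    exact (abs_mul_sub_mul_le_two_mul_abs _ (hx a) (hx' a)).trans (by rw [hy']; norm_num)
  have hprod : ∀ z : Fin d → ℝ, (∀ a, |z a| ≤ 1) → ∀ a b, |z a * z b| ≤ 1 := by
    intro z hz a b
    rw [abs_mul]
    exact mul_le_one₀ (hz a) (abs_nonneg _) (hz b)
  have hsecond := Finset.sum_le_card_nsmul
    (Finset.univ.filter (fun p : Fin d × Fin d => p.1 ∈ Sk ∨ p.2 ∈ Sk))
    (fun p => |(1 / 8) * (x p.1 * x p.2) - (1 / 8) * (x' p.1 * x' p.2)|) (1 / 4) fun p _ =>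
      (abs_mul_sub_mul_le_two_mul_abs (1 / 8) (hprod x hx p.1 p.2)
        (hprod x' hx' p.1 p.2)).trans (by norm_num)
  rw [nsmul_eq_mul, Finset.cast_card_filter_fst_mem_or_snd_mem, hcard, Fintype.card_fin]
    at hsecond
  linarith
end

section
/- Let n, d ∈ ℕ with d ≥ 1, let ε > 0, and set σ = 2(1 + 2d + d²)/ε. A record is a pair t = (x, y) with x : Fin d → ℝ, |x_a| ≤ 1 for all a, and y ∈ ℝ with |y| ≤ 1; a dataset is a function D : Fin n → record. For a dataset D define the coefficient vector q(D) indexed by Fin 1 ⊕ Fin d ⊕ (Fin d × Fin d) by q(D)₀ = ∑_i y_i², q(D)_a = −2·∑_i y_i·x_{ia}, and q(D)_{(a,b)} = ∑_i x_{ia}·x_{ib}. Let μ_D be the product measure on real vectors over this index type whose coordinate-j factor has density z ↦ (1/(2σ))·exp(−|z − q(D) j|/σ) with respect to Lebesgue measure. Then for any two datasets D, D' that agree at every index except possibly one, and every measurable set Z, μ_D(Z) ≤ exp(ε) · μ_{D'}(Z). -/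
open MeasureTheory

/-- The linear-regression coefficient vector of a dataset `D` of records
`(x, y)`: constant coefficient `∑_i y_i²`, first-order coefficients
`−2·∑_i y_i·x_{ia}`, and second-order coefficients `∑_i x_{ia}·x_{ib}`. -/
noncomputable def qLin {n d : ℕ} (D : Fin n → (Fin d → ℝ) × ℝ) :
    (Fin 1 ⊕ (Fin d ⊕ Fin d × Fin d)) → ℝ
  | Sum.inl _ => ∑ i, ((D i).2) ^ 2
  | Sum.inr (Sum.inl a) => -2 * ∑ i, (D i).2 * (D i).1 a
  | Sum.inr (Sum.inr (a, b)) => ∑ i, (D i).1 a * (D i).1 b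

/-- The product Laplace measure with scale `σ`, centered at `c : ι → ℝ`: the
product measure whose coordinate-j factor has density
`z ↦ (1/(2σ))·exp(−|z − c j|/σ)` with respect to Lebesgue measure. -/
noncomputable def piLap {ι : Type*} [Fintype ι] (σ : ℝ) (c : ι → ℝ) :
    Measure (ι → ℝ) :=
  Measure.pi fun j =>
    volume.withDensity fun z => ENNReal.ofReal ((1 / (2 * σ)) * Real.exp (-|z - c j| / σ))

/-- Coordinatewise domination of measures passes to product measures. -/
theorem pi_le_prod_smul_pi {ι : Type*} [Fintype ι] {α : ι → Type*}
    [∀ i, MeasurableSpace (α i)] {μ ν : ∀ i, Measure (α i)} [∀ i, SigmaFinite (μ i)]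
    {k : ι → ENNReal} (hk0 : ∏ i, k i ≠ 0) (hktop : ∏ i, k i ≠ ⊤)
    (h : ∀ i, μ i ≤ k i • ν i) (s : Set (∀ i, α i)) :
    Measure.pi μ s ≤ (∏ i, k i) * Measure.pi ν s := by
  have key : (∏ i, k i)⁻¹ • (Measure.pi μ).toOuterMeasure ≤
      OuterMeasure.pi fun i => (ν i).toOuterMeasure := by
    rw [OuterMeasure.le_pi]
    intro t _
    have hbox : Measure.pi μ (Set.univ.pi t) ≤ (∏ i, k i) * ∏ i, ν i (t i) := by
      rw [Measure.pi_pi, ← Finset.prod_mul_distrib]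
      exact Finset.prod_le_prod' fun i _ => h i (t i)
    exact (ENNReal.inv_mul_le_iff hk0 hktop).2 hbox
  have hs : (∏ i, k i)⁻¹ * Measure.pi μ s ≤ Measure.pi ν s := by
    refine (key s).trans ?_
    rw [Measure.pi_def]
    exact le_toMeasure_apply _ _ s
  exact (ENNReal.inv_mul_le_iff hk0 hktop).1 hs

/-- Moving the center of a Laplace density from `c'` to `c` costs at most a factor
`exp (|c - c'| / σ)`. -/
theorem laplace_withDensity_le_smul {σ : ℝ} (hσ : 0 < σ) (c c' : ℝ) :
    (volume.withDensity fun z : ℝ =>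
        ENNReal.ofReal ((1 / (2 * σ)) * Real.exp (-|z - c| / σ))) ≤
      ENNReal.ofReal (Real.exp (|c - c'| / σ)) • volume.withDensity fun z : ℝ =>
        ENNReal.ofReal ((1 / (2 * σ)) * Real.exp (-|z - c'| / σ)) := by
  rw [← withDensity_smul _ (by fun_prop)]
  refine withDensity_mono (Filter.Eventually.of_forall fun z => ?_)
  rw [Pi.smul_apply, smul_eq_mul, ← ENNReal.ofReal_mul (Real.exp_pos _).le, mul_left_comm,
    ← Real.exp_add, ← add_div]
  have := abs_sub_le z c c'
  dsimp only
  gcongr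
  linarith

theorem piLap_le_of_sum_abs_sub_le {ι : Type*} [Fintype ι] {σ ε : ℝ} (hσ : 0 < σ)
    {c c' : ι → ℝ} (h : ∑ j, |c j - c' j| ≤ ε * σ) (s : Set (ι → ℝ)) :
    piLap σ c s ≤ ENNReal.ofReal (Real.exp ε) * piLap σ c' s := by
  have hprod : ∏ j, ENNReal.ofReal (Real.exp (|c j - c' j| / σ)) =
      ENNReal.ofReal (Real.exp ((∑ j, |c j - c' j|) / σ)) := by
    rw [← ENNReal.ofReal_prod_of_nonneg fun _ _ => (Real.exp_pos _).le, ← Real.exp_sum,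
      Finset.sum_div]
  refine (pi_le_prod_smul_pi (k := fun j => ENNReal.ofReal (Real.exp (|c j - c' j| / σ)))
    ?_ ?_ (fun j => laplace_withDensity_le_smul hσ (c j) (c' j)) s).trans ?_
  · simp [hprod, Real.exp_pos]
  · simp [hprod]
  · rw [hprod]
    have : (∑ j, |c j - c' j|) / σ ≤ ε := (div_le_iff₀ hσ).2 h
    gcongr
    exact le_rfl

/-- The contribution of a single record to `qLin`. -/
def recordCoeff {d : ℕ} (t : (Fin d → ℝ) × ℝ) : (Fin 1 ⊕ (Fin d ⊕ Fin d × Fin d)) → ℝ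
  | Sum.inl _ => t.2 ^ 2
  | Sum.inr (Sum.inl a) => -2 * (t.2 * t.1 a)
  | Sum.inr (Sum.inr (a, b)) => t.1 a * t.1 b

theorem qLin_eq_sum_recordCoeff {n d : ℕ} (D : Fin n → (Fin d → ℝ) × ℝ)
    (j : Fin 1 ⊕ (Fin d ⊕ Fin d × Fin d)) : qLin D j = ∑ i, recordCoeff (D i) j := by
  rcases j with _ | _ | ⟨a, b⟩ <;> simp [qLin, recordCoeff, Finset.mul_sum]

theorem sum_abs_recordCoeff_le {d : ℕ} {t : (Fin d → ℝ) × ℝ} (hx : ∀ a, |t.1 a| ≤ 1)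
    (hy : |t.2| ≤ 1) : ∑ j, |recordCoeff t j| ≤ 1 + 2 * (d : ℝ) + (d : ℝ) ^ 2 := by
  have h0 : |t.2 ^ 2| ≤ 1 := by
    rw [abs_pow]
    exact pow_le_one₀ (abs_nonneg _) hy
  have h1 : ∑ a, |(-2 : ℝ) * (t.2 * t.1 a)| ≤ 2 * (d : ℝ) := by
    refine (Finset.sum_le_card_nsmul _ _ 2 fun a _ => ?_).trans_eq (by simp [mul_comm])
    rw [abs_mul, abs_mul, abs_neg, abs_two]
    linarith [mul_le_one₀ hy (abs_nonneg _) (hx a)]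
  have h2 : ∑ p : Fin d × Fin d, |t.1 p.1 * t.1 p.2| ≤ (d : ℝ) ^ 2 := by
    refine (Finset.sum_le_card_nsmul _ _ 1 fun p _ => ?_).trans_eq (by simp [sq])
    rw [abs_mul]
    exact mul_le_one₀ (hx _) (abs_nonneg _) (hx _)
  simp only [Fintype.sum_sum_type, recordCoeff, Finset.univ_unique, Finset.sum_singleton]
  linarith

theorem sum_abs_qLin_sub_le {n d : ℕ} {D D' : Fin n → (Fin d → ℝ) × ℝ}
    (hD : ∀ i, (∀ a, |(D i).1 a| ≤ 1) ∧ |(D i).2| ≤ 1)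
    (hD' : ∀ i, (∀ a, |(D' i).1 a| ≤ 1) ∧ |(D' i).2| ≤ 1)
    {r : Fin n} (hagree : ∀ i, i ≠ r → D i = D' i) :
    ∑ j, |qLin D j - qLin D' j| ≤ 2 * (1 + 2 * (d : ℝ) + (d : ℝ) ^ 2) := by
  have hsub : ∀ j, qLin D j - qLin D' j = recordCoeff (D r) j - recordCoeff (D' r) j := by
    intro j
    rw [qLin_eq_sum_recordCoeff, qLin_eq_sum_recordCoeff, ← Finset.sum_sub_distrib]
    refine Finset.sum_eq_single r (fun i _ hi => ?_) (by simp)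
    rw [hagree i hi, sub_self]
  calc ∑ j, |qLin D j - qLin D' j|
      ≤ ∑ j, (|recordCoeff (D r) j| + |recordCoeff (D' r) j|) :=
        Finset.sum_le_sum fun j _ => by rw [hsub]; exact abs_sub _ _
    _ ≤ 2 * (1 + 2 * (d : ℝ) + (d : ℝ) ^ 2) := by
        rw [Finset.sum_add_distrib]
        linarith [sum_abs_recordCoeff_le (hD r).1 (hD r).2,
          sum_abs_recordCoeff_le (hD' r).1 (hD' r).2]

/-- Theorem 1 of the paper instantiated for linear regression: perturbing the
coefficient vector `qLin D` with independent Laplace noise of scale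
`σ = 2(1 + 2d + d²)/ε` on each coordinate yields ε-differential privacy with
respect to a change of one record (with features and label in [−1,1]). -/
theorem functional_mechanism_linear_regression (n d : ℕ) (hd : 1 ≤ d)
    (ε : ℝ) (hε : 0 < ε) (σ : ℝ) (hσ : σ = 2 * (1 + 2 * (d : ℝ) + (d : ℝ) ^ 2) / ε)
    (D D' : Fin n → (Fin d → ℝ) × ℝ)
    (hD : ∀ i, (∀ a, |(D i).1 a| ≤ 1) ∧ |(D i).2| ≤ 1)
    (hD' : ∀ i, (∀ a, |(D' i).1 a| ≤ 1) ∧ |(D' i).2| ≤ 1)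
    (r : Fin n) (hagree : ∀ i, i ≠ r → D i = D' i)
    (Z : Set ((Fin 1 ⊕ (Fin d ⊕ Fin d × Fin d)) → ℝ)) (hZ : MeasurableSet Z) :
    piLap σ (qLin D) Z ≤ ENNReal.ofReal (Real.exp ε) * piLap σ (qLin D') Z := by
  have hσ_pos : 0 < σ := by
    rw [hσ]
    positivity
  refine piLap_le_of_sum_abs_sub_le hσ_pos ?_ Z
  rw [hσ, mul_div_cancel₀ _ hε.ne']
  exact sum_abs_qLin_sub_le hD hD' hagree
end
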